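/- The closed piecewise linear curve K_{1,4}, obtained from K_1 by 4 iterations of de Casteljau subdivision at parameter 1/2, is a simple closed curve; that is, its standard loop parameterization is injective on [0,1). -/

import Mathlib

open Set Real

noncomputable section

/-- Points in ℝ³. -/
abbrev V3 : Type := Fin 3 → ℝ

/-- The point (x, y, z) ∈ ℝ³. -/
def pt (x y z : ℝ) : V3 := ![x, y, z]

/-- Standard parameterization on `[0,1]` of the piecewise linear curve through
`P 0, P 1, …, P m`, traversing the `m` edges in order at constant speed. -/
def plPath (P : ℕ → V3) (m : ℕ) (t : ℝ) : V3 :=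
  let s := t * m
  let i := ⌊s⌋.toNat
  (1 - (s - i)) • P i + (s - i) • P (i + 1)

/-- An ambient isotopy between subsets `X` and `Y` of ℝ³: a continuous map
`H : ℝ³ × [0,1] → ℝ³` with `H(·,0) = id`, each `H(·,t)` a homeomorphism of ℝ³
onto itself, and `H(X × {1}) = Y`. -/
def AmbientIsotopic (X Y : Set V3) : Prop :=
  ∃ H : V3 → ℝ → V3,
    ContinuousOn (fun p : V3 × ℝ => H p.1 p.2) (univ ×ˢ Icc (0 : ℝ) 1) ∧
    (∀ x, H x 0 = x) ∧
    (∀ t ∈ Icc (0 : ℝ) 1, ∃ h : V3 ≃ₜ V3, ∀ x, H x t = h x) ∧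
    (fun x => H x 1) '' X = Y

/-- The round circle {(x, y, 0) : x² + y² = 1}. -/
def unitCircle : Set V3 := {p : V3 | ∃ x y : ℝ, x ^ 2 + y ^ 2 = 1 ∧ p = pt x y 0}

/-- The standard trefoil, the image of
`t ↦ ((2 + cos 3t) cos 2t, (2 + cos 3t) sin 2t, sin 3t)` for `t ∈ [0, 2π]`. -/
def trefoil : Set V3 :=
  {p : V3 | ∃ t ∈ Icc (0 : ℝ) (2 * π),
    p = pt ((2 + cos (3 * t)) * cos (2 * t)) ((2 + cos (3 * t)) * sin (2 * t)) (sin (3 * t))}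

/-- Cyclic vertex function determined by a list of points. -/
def vertsOf (L : List V3) : ℕ → V3 := fun m => L.getD (m % L.length) 0

/-- The vertices of the closed PL curve K₀. -/
def K0verts : List V3 :=
  [pt 0 9 20, pt (-15) (-95) (-50), pt 40 80 (-20), pt (-10) (-60) 58,
   pt (-60) 30 20, pt 40 (-60) (-60)]

/-- The vertices of the closed PL curve K₁ (the vertex (−10,−60,58) of K₀ is
replaced by (10,−60,58)). -/
def K1verts : List V3 :=
  [pt 0 9 20, pt (-15) (-95) (-50), pt 40 80 (-20), pt 10 (-60) 58,
   pt (-60) 30 20, pt 40 (-60) (-60)]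

/-- The standard loop parameterization of K₀. -/
def K0loop : ℝ → V3 := plPath (vertsOf K0verts) 6

/-- The standard loop parameterization of K₁. -/
def K1loop : ℝ → V3 := plPath (vertsOf K1verts) 6

/-- The closed PL curve K₀ as a subset of ℝ³. -/
def K0 : Set V3 := K0loop '' Icc 0 1

/-- The closed PL curve K₁ as a subset of ℝ³. -/
def K1 : Set V3 := K1loop '' Icc 0 1

/-- The de Casteljau points `P_i^{(k)}` at parameter 1/2:
`P_i^{(0)} = P_i` and `P_i^{(k)} = (P_i^{(k-1)} + P_{i+1}^{(k-1)})/2`. -/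
def dcQ (P : ℕ → V3) : ℕ → ℕ → V3
  | 0, i => P i
  | k + 1, i => (1 / 2 : ℝ) • (dcQ P k i + dcQ P k (i + 1))

/-- Left half of one de Casteljau subdivision step at parameter 1/2:
`(P_0^{(0)}, P_0^{(1)}, …, P_0^{(n)})`. -/
def dcLeft (P : ℕ → V3) : ℕ → V3 := fun i => dcQ P i 0

/-- Right half of one de Casteljau subdivision step at parameter 1/2 on a
degree-`n` control polygon: `(P_0^{(n)}, P_1^{(n-1)}, …, P_n^{(0)})`. -/
def dcRight (n : ℕ) (P : ℕ → V3) : ℕ → V3 := fun i => dcQ P (n - i) i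

/-- The list of `2^k` sub-control polygons, in order, produced by `k` iterations
of de Casteljau subdivision at parameter 1/2 on a degree-`n` control polygon. -/
def subPolys (n : ℕ) : ℕ → (ℕ → V3) → List (ℕ → V3)
  | 0, P => [P]
  | k + 1, P => subPolys n k (dcLeft P) ++ subPolys n k (dcRight n P)

/-- Vertex function (cyclic) of the concatenation, in order, of a list of
degree-`n` control polygons whose consecutive endpoints agree. -/
def concatVerts (n : ℕ) (L : List (ℕ → V3)) : ℕ → V3 :=
  fun m =>
    let m' := m % (n * L.length)
    (L.getD (m' / n) fun _ => 0) (m' % n)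

/-- The standard loop parameterization of the closed PL curve obtained from the
degree-6 control polygon `Q` by `k` iterations of de Casteljau subdivision at
parameter 1/2 (concatenating the `2^k` sub-control polygons in order). -/
def Ksub (k : ℕ) (Q : ℕ → V3) : ℝ → V3 :=
  plPath (concatVerts 6 (subPolys 6 k Q)) (6 * 2 ^ k)

/-- The Bézier curve of degree `n` with control points `P 0, …, P n`. -/
def bezier (n : ℕ) (P : ℕ → V3) (t : ℝ) : V3 :=
  ∑ i ∈ Finset.range (n + 1), ((n.choose i : ℝ) * t ^ i * (1 - t) ^ (n - i)) • P i

/-- Pascal-type sums over `ℤ`: the de Casteljau points without the factors `1 / 2`. -/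
def dcSum (p : ℕ → ℤ) : ℕ → ℕ → ℤ
  | 0, i => p i
  | k + 1, i => dcSum p k i + dcSum p k (i + 1)

/-- The left half of a subdivision step over `ℤ`, scaled by `2 ^ n`. -/
def dcLeftInt (n : ℕ) (p : ℕ → ℤ) : ℕ → ℤ := fun i => 2 ^ (n - i) * dcSum p i 0

/-- The right half of a subdivision step over `ℤ`, scaled by `2 ^ n`. -/
def dcRightInt (n : ℕ) (p : ℕ → ℤ) : ℕ → ℤ := fun i => 2 ^ i * dcSum p (n - i) i

/-- Iterated subdivision over `ℤ`, scaled by `2 ^ (n * k)`. -/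
def subPolysInt (n : ℕ) : ℕ → (ℕ → ℤ) → List (ℕ → ℤ)
  | 0, p => [p]
  | k + 1, p => subPolysInt n k (dcLeftInt n p) ++ subPolysInt n k (dcRightInt n p)

/-- The integer version of `concatVerts`. -/
def concatInt (n : ℕ) (L : List (ℕ → ℤ)) : ℕ → ℤ :=
  fun m =>
    let m' := m % (n * L.length)
    (L.getD (m' / n) fun _ => 0) (m' % n)

/-- The values `p` are `N` times the heights of the control points `P` in direction `φ`. -/
def ScaledHeights (φ : V3 →ₗ[ℝ] ℝ) (n : ℕ) (N : ℝ) (p : ℕ → ℤ) (P : ℕ → V3) : Prop :=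
  ∀ i ≤ n, (p i : ℝ) = N * φ (P i)

section Subdivision

variable {φ : V3 →ₗ[ℝ] ℝ} {n : ℕ} {N : ℝ} {p : ℕ → ℤ} {P : ℕ → V3}

lemma ScaledHeights.dcSum_eq (h : ScaledHeights φ n N p P) (k i : ℕ) (hki : k + i ≤ n) :
    (dcSum p k i : ℝ) = 2 ^ k * N * φ (dcQ P k i) := by
  induction k generalizing i with
  | zero => simpa [dcSum, dcQ] using h i (by omega)
  | succ k ih =>
    simp only [dcSum, dcQ, Int.cast_add, ih i (by omega), ih (i + 1) (by omega), map_smul,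
      map_add, smul_eq_mul]
    ring

lemma ScaledHeights.dcLeft (h : ScaledHeights φ n N p P) :
    ScaledHeights φ n (2 ^ n * N) (dcLeftInt n p) (dcLeft P) := by
  intro i hi
  have e : (2 : ℝ) ^ n = 2 ^ (n - i) * 2 ^ i := by rw [← pow_add, Nat.sub_add_cancel hi]
  simp only [dcLeftInt, _root_.dcLeft, Int.cast_mul, Int.cast_pow, Int.cast_ofNat,
    h.dcSum_eq i 0 (by omega), e]
  ring

lemma ScaledHeights.dcRight (h : ScaledHeights φ n N p P) :
    ScaledHeights φ n (2 ^ n * N) (dcRightInt n p) (dcRight n P) := by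
  intro i hi
  have e : (2 : ℝ) ^ n = 2 ^ (n - i) * 2 ^ i := by rw [← pow_add, Nat.sub_add_cancel hi]
  simp only [dcRightInt, _root_.dcRight, Int.cast_mul, Int.cast_pow, Int.cast_ofNat,
    h.dcSum_eq (n - i) i (by omega), e]
  ring

lemma ScaledHeights.subPolys (h : ScaledHeights φ n N p P) (k : ℕ) :
    List.Forall₂ (ScaledHeights φ n ((2 ^ n) ^ k * N)) (subPolysInt n k p) (subPolys n k P) := by
  induction k generalizing N p P with
  | zero => simpa [subPolysInt, _root_.subPolys] using h
  | succ k ih =>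
    have e : ((2 : ℝ) ^ n) ^ (k + 1) * N = (2 ^ n) ^ k * (2 ^ n * N) := by ring
    rw [e]
    exact List.rel_append (ih h.dcLeft) (ih h.dcRight)

lemma concatInt_eq {l : List (ℕ → ℤ)} {L : List (ℕ → V3)}
    (h : List.Forall₂ (ScaledHeights φ n N) l L) (hn : 0 < n) (m : ℕ) :
    (concatInt n l m : ℝ) = N * φ (concatVerts n L m) := by
  have key : ∀ q i, i ≤ n →
      (((l.getD q fun _ => 0) i : ℤ) : ℝ) = N * φ ((L.getD q fun _ => 0) i) := by
    induction h with
    | nil => simp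
    | cons hd _ ih =>
      intro q i hi
      cases q with
      | zero => simpa using hd i hi
      | succ q => simpa using ih q i hi
  simp only [concatInt, concatVerts, h.length_eq]
  exact key _ _ (Nat.mod_lt _ hn).le

end Subdivision

lemma plPath_eq_segment (P : ℕ → V3) {m : ℕ} (hm : 0 < m) {t : ℝ} (ht : t ∈ Ico (0 : ℝ) 1) :
    ∃ i < m, ∃ r ∈ Ico (0 : ℝ) 1, t * m = i + r ∧
      plPath P m t = (1 - r) • P i + r • P (i + 1) := by
  have hm' : (0 : ℝ) < m := by exact_mod_cast hm
  have h0 : 0 ≤ t * m := mul_nonneg ht.1 hm'.le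
  refine ⟨⌊t * m⌋₊, ?_, t * m - ⌊t * m⌋₊, ⟨?_, ?_⟩, by ring, rfl⟩
  · rw [Nat.floor_lt h0]
    nlinarith [ht.2]
  · linarith [Nat.floor_le h0]
  · linarith [Nat.lt_floor_add_one (t * m)]

/-- The heights of the edge from `f i` to `f (i + 1)` lie below those of the edge from `f j` to
`f (j + 1)`, strictly at the initial vertices. -/
def EdgeBelow {α : Type*} [LT α] [LE α] (f : ℕ → α) (i j : ℕ) : Prop :=
  f i < f j ∧ f i ≤ f (j + 1) ∧ f (i + 1) ≤ f j ∧ f (i + 1) ≤ f (j + 1)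

instance (f : ℕ → ℤ) (i j : ℕ) : Decidable (EdgeBelow f i j) :=
  inferInstanceAs (Decidable (_ ∧ _ ∧ _ ∧ _))

lemma EdgeBelow.segment_lt {f : ℕ → ℝ} {i j : ℕ} (h : EdgeBelow f i j) {r s : ℝ}
    (hr : r ∈ Ico (0 : ℝ) 1) (hs : s ∈ Ico (0 : ℝ) 1) :
    (1 - r) * f i + r * f (i + 1) < (1 - s) * f j + s * f (j + 1) := by
  obtain ⟨h₁, h₂, h₃, h₄⟩ := h
  obtain ⟨hr₀, hr₁⟩ := hr
  obtain ⟨hs₀, hs₁⟩ := hs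
  have a₁ := mul_pos (mul_pos (sub_pos.2 hr₁) (sub_pos.2 hs₁)) (sub_pos.2 h₁)
  have a₂ := mul_nonneg (mul_nonneg (sub_pos.2 hr₁).le hs₀) (sub_nonneg.2 h₂)
  have a₃ := mul_nonneg (mul_nonneg hr₀ (sub_pos.2 hs₁).le) (sub_nonneg.2 h₃)
  have a₄ := mul_nonneg (mul_nonneg hr₀ hs₀) (sub_nonneg.2 h₄)
  linarith

/-- If any two edges are separated by one of the linear functionals `φ a`, and each edge is
nondegenerate, the closed curve is simple. -/
lemma injOn_plPath_of_edgeBelow {ι : Type*} {P : ℕ → V3} {m : ℕ} (hm : 0 < m)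
    (φ : ι → V3 →ₗ[ℝ] ℝ)
    (hsep : ∀ j < m, ∀ i < j, ∃ a, EdgeBelow (fun k => φ a (P k)) i j ∨
      EdgeBelow (fun k => φ a (P k)) j i)
    (hne : ∀ i < m, P i ≠ P (i + 1)) :
    InjOn (plPath P m) (Ico 0 1) := by
  intro t ht u hu htu
  obtain ⟨i, hi, r, hr, hti, hPt⟩ := plPath_eq_segment P hm ht
  obtain ⟨j, hj, s, hs, huj, hPu⟩ := plPath_eq_segment P hm hu
  rw [hPt, hPu] at htu
  have hφ : ∀ a, (1 - r) * φ a (P i) + r * φ a (P (i + 1)) =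
      (1 - s) * φ a (P j) + s * φ a (P (j + 1)) := fun a => by
    simpa using congrArg (φ a) htu
  have hm' : (m : ℝ) ≠ 0 := by exact_mod_cast hm.ne'
  rcases lt_trichotomy i j with hij | rfl | hij
  · obtain ⟨a, h | h⟩ := hsep j hj i hij
    · exact absurd (hφ a) (h.segment_lt hr hs).ne
    · exact absurd (hφ a) (h.segment_lt hs hr).ne'
  · have h0 : (r - s) • (P (i + 1) - P i) = 0 := by
      rw [← sub_eq_zero] at htu
      rw [← htu]
      module
    have hrs : r = s := by
      rcases smul_eq_zero.1 h0 with h | h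
      · exact sub_eq_zero.1 h
      · exact absurd (sub_eq_zero.1 h).symm (hne i hi)
    exact mul_right_cancel₀ hm' (by rw [hti, huj, hrs])
  · obtain ⟨a, h | h⟩ := hsep i hi j hij
    · exact absurd (hφ a) (h.segment_lt hs hr).ne'
    · exact absurd (hφ a) (h.segment_lt hr hs).ne

/-- Three linear functionals that together separate the edges of `K₁,₄`. -/
def sepDir : Fin 3 → V3 →ₗ[ℝ] ℝ :=
  let x : Fin 3 → V3 →ₗ[ℝ] ℝ := LinearMap.proj
  ![x 0 + x 1 + x 2, (3 : ℝ) • x 0 - x 1 + x 2, x 2]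

/-- The values of the functionals `sepDir` at the vertices of `K₁`. -/
def K1heights (a : Fin 3) : ℕ → ℤ := fun m =>
  ((![[29, -160, 100, 8, -10, -80], [11, 0, 20, 148, -190, 120],
    [20, -50, -20, 58, 20, -60]] : Fin 3 → List ℤ) a).getD (m % 6) 0

/-- The values of the functionals `sepDir` at the vertices of `K₁,₄`, scaled by `2 ^ 24`. -/
def K14heights (a : Fin 3) : ℕ → ℤ := concatInt 6 (subPolysInt 6 4 (K1heights a))

lemma pt_zero (x y z : ℝ) : pt x y z 0 = x := rfl

lemma pt_one (x y z : ℝ) : pt x y z 1 = y := rfl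

lemma pt_two (x y z : ℝ) : pt x y z 2 = z := rfl

lemma K1heights_eq (a : Fin 3) : ScaledHeights (sepDir a) 6 1 (K1heights a) (vertsOf K1verts) := by
  intro i hi
  fin_cases a <;> interval_cases i <;>
    norm_num [sepDir, K1heights, vertsOf, K1verts, pt_zero, pt_one, pt_two]

lemma K14heights_eq (a : Fin 3) (m : ℕ) :
    (K14heights a m : ℝ) =
      (2 ^ 6) ^ 4 * sepDir a (concatVerts 6 (subPolys 6 4 (vertsOf K1verts)) m) := by
  simpa [K14heights] using concatInt_eq ((K1heights_eq a).subPolys 4) (by norm_num) m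

lemma EdgeBelow.of_K14heights {a : Fin 3} {i j : ℕ} (h : EdgeBelow (K14heights a) i j) :
    EdgeBelow (fun k => sepDir a (concatVerts 6 (subPolys 6 4 (vertsOf K1verts)) k)) i j := by
  have hpos : (0 : ℝ) < (2 ^ 6) ^ 4 := by positivity
  simpa only [EdgeBelow, ← Int.cast_lt (R := ℝ), ← Int.cast_le (R := ℝ), K14heights_eq,
    mul_lt_mul_iff_right₀ hpos, mul_le_mul_iff_right₀ hpos] using h

lemma K14heights_separated : ∀ j < 96, ∀ i < j,
    (EdgeBelow (K14heights 0) i j ∨ EdgeBelow (K14heights 0) j i) ∨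
    (EdgeBelow (K14heights 1) i j ∨ EdgeBelow (K14heights 1) j i) ∨
    (EdgeBelow (K14heights 2) i j ∨ EdgeBelow (K14heights 2) j i) := by
  decide +kernel

lemma K14heights_ne : ∀ i < 96, K14heights 0 i ≠ K14heights 0 (i + 1) := by
  decide +kernel

/-- The closed PL curve K₁,₄ (obtained from K₁ by 4 iterations of
de Casteljau subdivision at parameter 1/2) is a simple closed curve: its
standard loop parameterization is injective on `[0,1)`. -/
theorem K14_is_simple_closed : Set.InjOn (Ksub 4 (vertsOf K1verts)) (Ico 0 1) := by
  refine injOn_plPath_of_edgeBelow (by norm_num) sepDir (fun j hj i hij => ?_) fun i hi h => ?_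
  · rcases K14heights_separated j hj i hij with h | h | h
    all_goals exact ⟨_, h.imp .of_K14heights .of_K14heights⟩
  · refine K14heights_ne i hi ?_
    rw [← Int.cast_inj (α := ℝ), K14heights_eq, K14heights_eq, h]
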